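/- The number of Graham equivalence classes of trees on n vertices is at least e^{c(log n)^{3/2}} for some constant c > 0 and all sufficiently large n. -/

import Mathlib

/-- A finite simple graph, bundled with its (finite) vertex type. -/
structure FGraph where
  V : Type
  [fin : Fintype V]
  G : SimpleGraph V

attribute [instance] FGraph.fin

/-- The line graph of a bundled finite graph. -/
noncomputable def FGraph.line (H : FGraph) : FGraph :=
  letI : Fintype H.G.edgeSet := Fintype.ofFinite _
  FGraph.mk H.G.edgeSet H.G.lineGraph

/-- The `k`-th iterated line graph. -/
noncomputable def lineIter : ℕ → FGraph → FGraph
  | 0, H => H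
  | (k + 1), H => (lineIter k H).line

/-- Embeddings of graphs induce embeddings of line graphs. -/
theorem line_adj_iff {V : Type} (G : SimpleGraph V) (e e' : G.edgeSet) :
    G.lineGraph.Adj e e' ↔ e ≠ e' ∧ ∃ v, v ∈ e.1 ∧ v ∈ e'.1 := by
  rw [SimpleGraph.lineGraph_adj_iff_exists]

/-- Embeddings of graphs induce embeddings of line graphs. -/
def lineEmb {V W : Type} {G : SimpleGraph V} {G' : SimpleGraph W} (f : G ↪g G') :
    G.lineGraph ↪g G'.lineGraph where
  toEmbedding := f.mapEdgeSet
  map_rel_iff' := by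
    intro e e'
    rw [line_adj_iff, line_adj_iff]
    have hinj : f.mapEdgeSet e ≠ f.mapEdgeSet e' ↔ e ≠ e' := f.mapEdgeSet.injective.ne_iff
    have key : ∀ e : G.edgeSet, (f.mapEdgeSet e).1 = Sym2.map f e.1 := fun _ => rfl
    refine and_congr hinj ?_
    rw [key, key]
    constructor
    · rintro ⟨w, h1, h2⟩
      rw [Sym2.mem_map] at h1 h2
      obtain ⟨a, ha, rfl⟩ := h1
      obtain ⟨b, hb, hab⟩ := h2
      have := f.injective hab
      subst this
      exact ⟨_, ha, hb⟩
    · rintro ⟨w, h1, h2⟩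
      exact ⟨f w, Sym2.mem_map.2 ⟨w, h1, rfl⟩, Sym2.mem_map.2 ⟨w, h2, rfl⟩⟩

theorem lineEmb_coe {V W : Type} {G : SimpleGraph V} {G' : SimpleGraph W} (f : G ↪g G')
    (e : G.edgeSet) : (lineEmb f e).1 = Sym2.map f e.1 := rfl

/-- The range of the induced embedding consists of the edges supported in the range. -/
theorem lineEmb_range {V W : Type} {G : SimpleGraph V} {G' : SimpleGraph W} (f : G ↪g G')
    (e : G'.edgeSet) : e ∈ Set.range (lineEmb f) ↔ ∀ v ∈ e.1, v ∈ Set.range f := by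
  constructor
  · rintro ⟨e0, rfl⟩ v hv
    rw [lineEmb_coe, Sym2.mem_map] at hv
    obtain ⟨a, -, rfl⟩ := hv
    exact ⟨a, rfl⟩
  · obtain ⟨e, he⟩ := e
    induction e using Sym2.ind with
    | _ x y =>
      intro h
      obtain ⟨a, rfl⟩ := h x (by simp)
      obtain ⟨b, rfl⟩ := h y (by simp)
      have hab : G.Adj a b := by simpa using he
      exact ⟨⟨s(a, b), hab⟩, Subtype.ext rfl⟩

/-- `H'` arises from `H` by adding a leaf at the end of a pendant path with `l` edges whose base
has two further neighbours. -/
def LeafExt (l : ℕ) (H H' : FGraph) : Prop :=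
  ∃ f : H.G ↪g H'.G, ∃ q : ℕ → H'.V, ∃ a b : H'.V,
    (∀ v, v ∈ Set.range f ↔ v ≠ q 0) ∧
    (∀ i ≤ l + 1, ∀ j ≤ l + 1, q i = q j → i = j) ∧
    (∀ v, H'.G.Adj (q 0) v ↔ v = q 1) ∧
    (∀ j < l, ∀ v, H'.G.Adj (q (j + 1)) v ↔ v = q j ∨ v = q (j + 2)) ∧
    a ≠ b ∧ H'.G.Adj (q (l + 1)) a ∧ H'.G.Adj (q (l + 1)) b ∧ a ≠ q l ∧ b ≠ q l

theorem ext_adj {l : ℕ} {H' : FGraph} {q : ℕ → H'.V}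
    (h0 : ∀ v, H'.G.Adj (q 0) v ↔ v = q 1)
    (h1 : ∀ j < l, ∀ v, H'.G.Adj (q (j + 1)) v ↔ v = q j ∨ v = q (j + 2)) :
    ∀ j ≤ l, H'.G.Adj (q j) (q (j + 1)) := by
  intro j hj
  rcases j with _ | j
  · exact (h0 _).2 rfl
  · exact (h1 j (by omega) _).2 (Or.inr rfl)

/-- The leaf edge: the complement of the range of the line embedding. -/
theorem ext_range {V W : Type} {G : SimpleGraph V} {G' : SimpleGraph W} (f : G ↪g G')
    (q0 q1 : W) (hr : ∀ v, v ∈ Set.range f ↔ v ≠ q0) (h0 : ∀ v, G'.Adj q0 v ↔ v = q1)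
    (e0 : G'.edgeSet) (he0 : e0.1 = s(q0, q1)) (e : G'.edgeSet) :
    e ∈ Set.range (lineEmb f) ↔ e ≠ e0 := by
  rw [lineEmb_range]
  constructor
  · rintro h rfl
    exact (hr q0).1 (h q0 (by rw [he0]; simp)) rfl
  · intro h v hv
    rw [hr]
    rintro rfl
    apply h
    apply Subtype.ext
    rw [he0]
    obtain ⟨w, hw⟩ := hv
    have hA : G'.Adj v w := by
      have := e.2
      rw [hw] at this
      exact this
    rw [hw, (h0 w).1 hA]

theorem adj_edge_left {V : Type} {G : SimpleGraph V} {x y : V} (e e' : G.edgeSet)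
    (he : e.1 = s(x, y)) :
    G.lineGraph.Adj e e' ↔ e' ≠ e ∧
      ((∃ v, G.Adj x v ∧ e'.1 = s(x, v)) ∨ (∃ v, G.Adj y v ∧ e'.1 = s(y, v))) := by
  rw [line_adj_iff, ne_comm]
  refine and_congr Iff.rfl ?_
  rw [he]
  constructor
  · rintro ⟨v, hv, ⟨w, hw⟩⟩
    have hA : G.Adj v w := by
      have := e'.2
      rw [hw] at this
      exact this
    rcases Sym2.mem_iff.1 hv with rfl | rfl
    · exact Or.inl ⟨w, hA, hw⟩
    · exact Or.inr ⟨w, hA, hw⟩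
  · rintro (⟨v, -, hv⟩ | ⟨v, -, hv⟩)
    · exact ⟨x, by simp, by rw [hv]; simp⟩
    · exact ⟨y, by simp, by rw [hv]; simp⟩

theorem ext_line {l : ℕ} {H H' : FGraph} (h : LeafExt (l + 1) H H') : LeafExt l H.line H'.line := by
  obtain ⟨f, q, a, b, hr, hinj, h0, h1, hab, ha, hb, ha', hb'⟩ := h
  have hadj := ext_adj h0 h1
  have hex : ∀ j, ∃ e : H'.G.edgeSet, j ≤ l + 1 → e.1 = s(q j, q (j + 1)) := by
    intro j
    by_cases hj : j ≤ l + 1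
    · exact ⟨⟨s(q j, q (j + 1)), hadj j hj⟩, fun _ => rfl⟩
    · exact ⟨⟨s(q 0, q 1), hadj 0 (by omega)⟩, fun h => absurd h hj⟩
  choose q' hq' using hex
  have hq0 := hq' 0 (by omega)
  refine ⟨lineEmb f, q', ⟨s(q (l + 2), a), ha⟩, ⟨s(q (l + 2), b), hb⟩, ?_, ?_, ?_, ?_, ?_, ?_, ?_,
    ?_, ?_⟩
  · exact ext_range f (q 0) (q 1) hr h0 (q' 0) hq0
  · intro i hi j hj hij
    have h2 : s(q i, q (i + 1)) = s(q j, q (j + 1)) := by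
      rw [← hq' i hi, ← hq' j hj, hij]
    rcases Sym2.eq_iff.1 h2 with ⟨h3, -⟩ | ⟨h3, h4⟩
    · exact hinj i (by omega) j (by omega) h3
    · have := hinj i (by omega) (j + 1) (by omega) h3
      have := hinj (i + 1) (by omega) j (by omega) h4
      omega
  · intro e
    refine (adj_edge_left (q' 0) e hq0).trans ?_
    constructor
    · rintro ⟨hne, ⟨v, hv, he⟩ | ⟨v, hv, he⟩⟩
      · rw [h0] at hv
        subst hv
        exact absurd (Subtype.ext (he.trans hq0.symm)) hne
      · rw [h1 0 (by omega)] at hv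
        rcases hv with rfl | rfl
        · exact absurd (Subtype.ext (he.trans (Sym2.eq_swap.trans hq0.symm))) hne
        · exact Subtype.ext (he.trans (hq' 1 (by omega)).symm)
    · rintro rfl
      refine ⟨?_, Or.inr ⟨q 2, hadj 1 (by omega), hq' 1 (by omega)⟩⟩
      intro hh
      have h2 : s(q 1, q 2) = s(q 0, q 1) := by rw [← hq' 1 (by omega), ← hq0, hh]
      rcases Sym2.eq_iff.1 h2 with ⟨h3, -⟩ | ⟨-, h3⟩
      · have := hinj _ (by omega) _ (by omega) h3
        omega
      · have := hinj _ (by omega) _ (by omega) h3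
        omega
  · intro j hj e
    have hj1 := hq' (j + 1) (by omega)
    refine (adj_edge_left (q' (j + 1)) e hj1).trans ?_
    have hne : ∀ i ≤ l + 1, i ≠ j + 1 → q' i ≠ q' (j + 1) := by
      intro i hi hij hh
      have h2 : s(q i, q (i + 1)) = s(q (j + 1), q (j + 1 + 1)) := by
        rw [← hq' i hi, ← hj1, hh]
      rcases Sym2.eq_iff.1 h2 with ⟨h3, -⟩ | ⟨h3, h4⟩
      · exact hij (hinj i (by omega) _ (by omega) h3)
      · have := hinj i (by omega) _ (by omega) h3
        have := hinj (i + 1) (by omega) _ (by omega) h4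
        omega
    constructor
    · rintro ⟨hne', ⟨v, hv, he⟩ | ⟨v, hv, he⟩⟩
      · rw [h1 j (by omega)] at hv
        rcases hv with rfl | rfl
        · exact Or.inl (Subtype.ext (he.trans (Sym2.eq_swap.trans (hq' j (by omega)).symm)))
        · exact absurd (Subtype.ext (he.trans hj1.symm)) hne'
      · rw [h1 (j + 1) (by omega)] at hv
        rcases hv with rfl | rfl
        · exact absurd (Subtype.ext (he.trans (Sym2.eq_swap.trans hj1.symm))) hne'
        · exact Or.inr (Subtype.ext (he.trans (hq' (j + 2) (by omega)).symm))
    · rintro (rfl | rfl)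
      · exact ⟨hne j (by omega) (by omega), Or.inl ⟨q j, (hadj j (by omega)).symm,
          (hq' j (by omega)).trans Sym2.eq_swap⟩⟩
      · exact ⟨hne (j + 2) (by omega) (by omega), Or.inr ⟨q (j + 3), hadj (j + 2) (by omega),
          (hq' (j + 2) (by omega))⟩⟩
  · intro hh
    have h2 : s(q (l + 2), a) = s(q (l + 2), b) := congrArg Subtype.val hh
    exact hab (Sym2.congr_right.1 h2)
  · refine (adj_edge_left (q' (l + 1)) _ (hq' (l + 1) le_rfl)).2 ⟨?_, Or.inr ⟨a, ha, rfl⟩⟩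
    intro hh
    have h2 : s(q (l + 2), a) = s(q (l + 1), q (l + 2)) := by
      rw [← hq' (l + 1) le_rfl, ← hh]
    rw [Sym2.eq_swap (a := q (l + 1))] at h2
    exact ha' (Sym2.congr_right.1 h2)
  · refine (adj_edge_left (q' (l + 1)) _ (hq' (l + 1) le_rfl)).2 ⟨?_, Or.inr ⟨b, hb, rfl⟩⟩
    intro hh
    have h2 : s(q (l + 2), b) = s(q (l + 1), q (l + 2)) := by
      rw [← hq' (l + 1) le_rfl, ← hh]
    rw [Sym2.eq_swap (a := q (l + 1))] at h2
    exact hb' (Sym2.congr_right.1 h2)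
  · intro hh
    have h2 : s(q (l + 2), a) = s(q l, q (l + 1)) := by
      rw [← hq' l (by omega), ← hh]
    rcases Sym2.eq_iff.1 h2 with ⟨h3, -⟩ | ⟨h3, -⟩ <;>
    · have := hinj _ (by omega) _ (by omega) h3
      omega
  · intro hh
    have h2 : s(q (l + 2), b) = s(q l, q (l + 1)) := by
      rw [← hq' l (by omega), ← hh]
    rcases Sym2.eq_iff.1 h2 with ⟨h3, -⟩ | ⟨h3, -⟩ <;>
    · have := hinj _ (by omega) _ (by omega) h3
      omega

theorem ext_iter {H H' : FGraph} (k l : ℕ) (h : LeafExt (l + k) H H') :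
    LeafExt l (lineIter k H) (lineIter k H') := by
  induction k generalizing l with
  | zero => exact h
  | succ k ih => exact ext_line (ih (l + 1) (by rwa [show l + 1 + k = l + (k + 1) by omega]))

theorem ext_card {l : ℕ} {H H' : FGraph} (h : LeafExt l H H') :
    Nat.card H'.V = Nat.card H.V + 1 := by
  obtain ⟨f, q, a, b, hr, -⟩ := h
  have h1 : (Set.range f).ncard = Nat.card H.V := by
    rw [← Set.image_univ, Set.ncard_image_of_injective _ f.injective, Set.ncard_univ]
  have h2 : Set.range f = {q 0}ᶜ := by
    ext v; simpa using hr v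
  have h3 := Set.ncard_add_ncard_compl ({q 0} : Set H'.V)
  rw [← h2, h1, Set.ncard_singleton] at h3
  omega

theorem ext_card_two {H H' : FGraph} (h : LeafExt 0 H H') :
    Nat.card H.line.line.V + 2 ≤ Nat.card H'.line.line.V := by
  obtain ⟨f, q, a, b, hr, hinj, h0, h1, hab, ha, hb, ha', hb'⟩ := h
  have hA : H'.G.Adj (q 0) (q 1) := (h0 _).2 rfl
  let e0 : H'.G.edgeSet := ⟨s(q 0, q 1), hA⟩
  let ea : H'.G.edgeSet := ⟨s(q 1, a), ha⟩
  let eb : H'.G.edgeSet := ⟨s(q 1, b), hb⟩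
  have hr' := ext_range f (q 0) (q 1) hr h0 e0 rfl
  have hea : ea ≠ e0 := by
    intro hh
    have h2 : s(q 1, a) = s(q 0, q 1) := congrArg Subtype.val hh
    rw [Sym2.eq_swap (a := q 0)] at h2
    exact ha' (Sym2.congr_right.1 h2)
  have heb : eb ≠ e0 := by
    intro hh
    have h2 : s(q 1, b) = s(q 0, q 1) := congrArg Subtype.val hh
    rw [Sym2.eq_swap (a := q 0)] at h2
    exact hb' (Sym2.congr_right.1 h2)
  have heab : ea ≠ eb := by
    intro hh
    have h2 : s(q 1, a) = s(q 1, b) := congrArg Subtype.val hh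
    exact hab (Sym2.congr_right.1 h2)
  have hAa : H'.G.lineGraph.Adj e0 ea :=
    (adj_edge_left e0 ea rfl).2 ⟨hea, Or.inr ⟨a, ha, rfl⟩⟩
  have hAb : H'.G.lineGraph.Adj e0 eb :=
    (adj_edge_left e0 eb rfl).2 ⟨heb, Or.inr ⟨b, hb, rfl⟩⟩
  let Ea : H'.line.line.V := ⟨s(e0, ea), hAa⟩
  let Eb : H'.line.line.V := ⟨s(e0, eb), hAb⟩
  let F : H.line.line.V → H'.line.line.V := fun x => lineEmb (lineEmb f) x
  have hF : Function.Injective F := (lineEmb (lineEmb f)).injective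
  have hEab : Ea ≠ Eb := by
    intro hh
    have h2 : s(e0, ea) = s(e0, eb) := congrArg Subtype.val hh
    exact heab (Sym2.congr_right.1 h2)
  have hnot : ∀ (e : H'.G.edgeSet) (hE : H'.G.lineGraph.Adj e0 e),
      (⟨s(e0, e), hE⟩ : H'.G.lineGraph.edgeSet) ∉ Set.range F := by
    intro e hE hh
    have := (lineEmb_range (lineEmb f) ⟨s(e0, e), hE⟩).1 hh e0 (by simp)
    exact (hr' e0).1 this rfl
  have hd : Disjoint (Set.range F) {Ea, Eb} := by
    rw [Set.disjoint_right]
    rintro x (rfl | rfl)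
    · exact hnot ea hAa
    · exact hnot eb hAb
  have h1 : (Set.range F).ncard = Nat.card H.line.line.V := by
    rw [← Set.image_univ, Set.ncard_image_of_injective _ hF, Set.ncard_univ]
  have h2 := Set.ncard_union_eq hd
  rw [h1, Set.ncard_pair hEab] at h2
  rw [← h2, ← Set.ncard_univ]
  exact Set.ncard_le_ncard (Set.subset_univ _)

theorem iso_line {H H' : FGraph} (h : Nonempty (H.G ≃g H'.G)) :
    Nonempty (H.line.G ≃g H'.line.G) := by
  obtain ⟨f⟩ := h
  have hs : Function.Surjective (lineEmb f.toEmbedding) := by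
    intro e
    exact (lineEmb_range f.toEmbedding e).2 fun v _ => f.surjective v
  exact ⟨RelIso.ofSurjective (lineEmb f.toEmbedding) hs⟩

theorem iso_iter {H H' : FGraph} (h : Nonempty (H.G ≃g H'.G)) (k : ℕ) :
    Nonempty ((lineIter k H).G ≃g (lineIter k H').G) := by
  induction k with
  | zero => exact h
  | succ k ih => exact iso_line ih

/-! ### Spiders -/

/-- The parent map of the infinite spider with centre `(0, 0)`. -/
def spPar (p : ℕ × ℕ) : ℕ × ℕ := if p.2 ≤ 1 then (0, 0) else (p.1, p.2 - 1)

/-- The ambient spider graph. -/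
def spG : SimpleGraph (ℕ × ℕ) := SimpleGraph.fromRel (fun u v => spPar u = v)

/-- Vertices of the spider with `d` legs of lengths `l i`. -/
def spF (d : ℕ) (l : ℕ → ℕ) : Finset (ℕ × ℕ) :=
  insert (0, 0) ((Finset.range d).biUnion fun i => (Finset.Icc 1 (l i)).image fun t => (i, t))

theorem mem_spF {d : ℕ} {l : ℕ → ℕ} {p : ℕ × ℕ} :
    p ∈ spF d l ↔ p = (0, 0) ∨ (p.1 < d ∧ 1 ≤ p.2 ∧ p.2 ≤ l p.1) := by
  obtain ⟨i, t⟩ := p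
  simp only [spF, Finset.mem_insert, Finset.mem_biUnion, Finset.mem_range, Finset.mem_image,
    Finset.mem_Icc, Prod.mk.injEq]
  constructor
  · rintro (h | ⟨a, ha, b, hb, rfl, rfl⟩)
    · exact Or.inl h
    · exact Or.inr ⟨ha, hb⟩
  · rintro (h | ⟨ha, hb⟩)
    · exact Or.inl h
    · exact Or.inr ⟨i, ha, t, hb, rfl, rfl⟩

theorem card_spF (d : ℕ) (l : ℕ → ℕ) : (spF d l).card = ∑ i ∈ Finset.range d, l i + 1 := by
  rw [spF, Finset.card_insert_of_notMem, Finset.card_biUnion]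
  · congr 1
    refine Finset.sum_congr rfl fun i _ => ?_
    rw [Finset.card_image_of_injective _ (fun a b h => (Prod.mk.inj h).2)]
    simp
  · intro i _ j _ hij
    rw [Function.onFun, Finset.disjoint_left]
    intro p hp hq
    simp only [Finset.mem_image] at hp hq
    obtain ⟨a, -, rfl⟩ := hp
    obtain ⟨b, -, h⟩ := hq
    exact hij (Prod.mk.inj h).1.symm
  · simp

/-- The spider as a bundled finite graph. -/
def Spider (d : ℕ) (l : ℕ → ℕ) : FGraph :=
  FGraph.mk {p // p ∈ spF d l} (spG.comap Subtype.val)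

theorem spider_tree (d : ℕ) (l : ℕ → ℕ) : (Spider d l).G.IsTree := by
  classical
  have hpar : ∀ p ∈ spF d l, spPar p ∈ spF d l := by
    rintro ⟨i, t⟩ hp
    rw [mem_spF] at hp ⊢
    unfold spPar
    split_ifs with h
    · exact Or.inl rfl
    · rcases hp with hp | hp
      · simp only [Prod.mk.injEq] at hp
        simp only at h
        omega
      · simp only at h hp ⊢
        exact Or.inr ⟨hp.1, by omega, by omega⟩
  let r : (Spider d l).V := ⟨(0, 0), mem_spF.2 (Or.inl rfl)⟩
  let P : (Spider d l).V → (Spider d l).V := fun v => ⟨spPar v.1, hpar v.1 v.2⟩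
  have hne : ∀ v : (Spider d l).V, v ≠ r → v.1.2 ≠ 0 := by
    rintro ⟨⟨i, t⟩, hv⟩ hvr h
    rcases mem_spF.1 hv with h2 | h2
    · exact hvr (Subtype.ext h2)
    · simp only at h h2
      omega
  have hlt : ∀ v : (Spider d l).V, v ≠ r → (P v).1.2 < v.1.2 := by
    intro v hv
    have := hne v hv
    change (spPar v.1).2 < v.1.2
    unfold spPar
    split_ifs
    · simp only; omega
    · simp only; omega
  have hadj : ∀ v : (Spider d l).V, v ≠ r → (Spider d l).G.Adj v (P v) := by
    intro v hv
    have h1 := hlt v hv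
    change spG.Adj v.1 (P v).1
    rw [spG, SimpleGraph.fromRel_adj]
    refine ⟨fun h => ?_, Or.inl rfl⟩
    rw [← h] at h1
    exact lt_irrefl _ h1
  have hreach : ∀ k, ∀ v : (Spider d l).V, v.1.2 = k → (Spider d l).G.Reachable v r := by
    intro k
    induction k using Nat.strong_induction_on with
    | _ k ih =>
      intro v hv
      by_cases hvr : v = r
      · rw [hvr]
      · exact (hadj v hvr).reachable.trans (ih _ (hv ▸ hlt v hvr) _ rfl)
  have hconn : (Spider d l).G.Connected := by
    have : Nonempty (Spider d l).V := ⟨r⟩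
    exact ⟨fun u v => (hreach _ u rfl).trans (hreach _ v rfl).symm⟩
  rw [SimpleGraph.isTree_iff_connected_and_card]
  refine ⟨hconn, le_antisymm ?_ hconn.card_vert_le_card_edgeSet_add_one⟩
  let g : {v : (Spider d l).V // v ≠ r} → (Spider d l).G.edgeSet :=
    fun v => ⟨s(v.1, P v.1), hadj v.1 v.2⟩
  have hPr : P r = r := Subtype.ext rfl
  have hg : Function.Surjective g := by
    rintro ⟨e, he⟩
    induction e using Sym2.ind with
    | _ x y =>
      have hxy : spG.Adj x.1 y.1 := he
      rw [spG, SimpleGraph.fromRel_adj] at hxy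
      obtain ⟨hn, h | h⟩ := hxy
      · have hPy : P x = y := Subtype.ext h
        have hx : x ≠ r := by
          rintro rfl
          rw [hPr] at hPy
          exact hn (congrArg Subtype.val hPy)
        refine ⟨⟨x, hx⟩, Subtype.ext ?_⟩
        change s(x, P x) = s(x, y)
        rw [hPy]
      · have hPy : P y = x := Subtype.ext h
        have hx : y ≠ r := by
          rintro rfl
          rw [hPr] at hPy
          exact hn (congrArg Subtype.val hPy).symm
        refine ⟨⟨y, hx⟩, Subtype.ext ?_⟩
        change s(y, P y) = s(x, y)
        rw [hPy, Sym2.eq_swap]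
  have h1 := Nat.card_le_card_of_surjective g hg
  have h2 : ({r}ᶜ : Set (Spider d l).V).ncard + 1 = Nat.card (Spider d l).V := by
    have := Set.ncard_add_ncard_compl ({r} : Set (Spider d l).V)
    rw [Set.ncard_singleton] at this
    omega
  have h3 : Nat.card {v : (Spider d l).V // v ≠ r} = ({r}ᶜ : Set (Spider d l).V).ncard := rfl
  omega

theorem spG_adj (i t : ℕ) (v : ℕ × ℕ) :
    spG.Adj (i, t + 1) v ↔ v = (if t = 0 then (0, 0) else (i, t)) ∨ v = (i, t + 2) := by
  obtain ⟨j, s⟩ := v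
  rw [spG, SimpleGraph.fromRel_adj]
  simp only [spPar]
  split_ifs <;> simp only [Prod.mk.injEq, ne_eq, Nat.add_sub_cancel] <;> omega

theorem spG_adj_zero (i : ℕ) : spG.Adj (0, 0) (i, 1) := by
  rw [spG, SimpleGraph.fromRel_adj]
  simp [spPar]

theorem spider_ext (d : ℕ) (l : ℕ → ℕ) (i : ℕ) (hi : i < d) (hd : 3 ≤ d)
    (hl : ∀ j < d, 1 ≤ l j) :
    LeafExt (l i) (Spider d l) (Spider d (Function.update l i (l i + 1))) := by
  set l' := Function.update l i (l i + 1) with hl'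
  have hii : l' i = l i + 1 := by simp [l']
  have hij : ∀ j, j ≠ i → l' j = l j := fun j hj => by simp [l', hj]
  have hsub : ∀ p, p ∈ spF d l → p ∈ spF d l' := by
    rintro ⟨j, t⟩ hp
    rw [mem_spF] at hp ⊢
    refine hp.imp id fun hp => ⟨hp.1, hp.2.1, ?_⟩
    simp only at hp ⊢
    by_cases h : j = i
    · subst h; omega
    · rw [hij j h]; exact hp.2.2
  let f : (Spider d l).G ↪g (Spider d l').G :=
    { toFun := fun v => ⟨v.1, hsub v.1 v.2⟩
      inj' := fun u v h => Subtype.ext (congrArg (fun w : (Spider d l').V => w.1) h)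
      map_rel_iff' := Iff.rfl }
  let q0 : ℕ → ℕ × ℕ := fun j => if l i + 1 - j = 0 then (0, 0) else (i, l i + 1 - j)
  have hq0 : ∀ j, q0 j ∈ spF d l' := by
    intro j
    rw [mem_spF]
    simp only [q0]
    split_ifs with h
    · exact Or.inl rfl
    · refine Or.inr ⟨hi, by simp only; omega, ?_⟩
      simp only [hii]
      omega
  have hq : ∀ j t, t + 1 + j = l i + 1 → q0 j = (i, t + 1) := by
    intro j t h
    simp only [q0]
    rw [if_neg (by omega), show l i + 1 - j = t + 1 by omega]
  have hqe : q0 (l i + 1) = (0, 0) := by simp [q0]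
  have hli := hl i hi
  obtain ⟨a, b, ha, hb, hab, hai, hbi⟩ :
      ∃ a b : ℕ, a < d ∧ b < d ∧ a ≠ b ∧ a ≠ i ∧ b ≠ i := by
    by_cases h0 : i = 0
    · exact ⟨1, 2, by omega, by omega, by omega, by omega, by omega⟩
    by_cases h1 : i = 1
    · exact ⟨0, 2, by omega, by omega, by omega, by omega, by omega⟩
    · exact ⟨0, 1, by omega, by omega, by omega, by omega, by omega⟩
  have hm : ∀ a, a < d → a ≠ i → (a, 1) ∈ spF d l' := by
    intro a ha hai
    rw [mem_spF]
    exact Or.inr ⟨ha, le_rfl, by simp only; rw [hij a hai]; exact hl a ha⟩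
  refine ⟨f, fun j => ⟨q0 j, hq0 j⟩, ⟨(a, 1), hm a ha hai⟩, ⟨(b, 1), hm b hb hbi⟩,
    ?_, ?_, ?_, ?_, ?_, ?_, ?_, ?_, ?_⟩
  · rintro ⟨⟨j, t⟩, hv⟩
    have h00 : q0 0 = (i, l i + 1) := hq 0 (l i) (by omega)
    constructor
    · rintro ⟨w, hw⟩ h
      have h1 : w.1 = q0 0 := congrArg (fun w : (Spider d l').V => w.1) (hw.trans h)
      have h2 := w.2
      rw [h1, h00, mem_spF] at h2
      simp only [Prod.mk.injEq] at h2
      omega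
    · intro h
      have hmem : (j, t) ∈ spF d l := by
        rw [mem_spF] at hv ⊢
        refine hv.imp id fun hp => ⟨hp.1, hp.2.1, ?_⟩
        simp only at hp ⊢
        by_cases hji : j = i
        · subst hji
          have : t ≠ l j + 1 := by
            rintro rfl
            exact h (Subtype.ext h00.symm)
          omega
        · rw [← hij j hji]; exact hp.2.2
      exact ⟨⟨(j, t), hmem⟩, rfl⟩
  · intro x hx y hy h
    have h1 : q0 x = q0 y := congrArg Subtype.val h
    simp only [q0] at h1
    split_ifs at h1 <;> simp only [Prod.mk.injEq] at h1 <;> omega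
  · intro v
    have h1 : (Spider d l').G.Adj ⟨q0 0, hq0 0⟩ v ↔ spG.Adj (q0 0) v.1 := Iff.rfl
    rw [h1, hq 0 (l i) (by omega), spG_adj, if_neg (by omega)]
    have h2 : (v = ⟨q0 1, hq0 1⟩) ↔ v.1 = q0 1 := Subtype.ext_iff
    rw [h2, hq 1 (l i - 1) (by omega), show l i - 1 + 1 = l i by omega]
    constructor
    · rintro (h | h)
      · exact h
      · have := v.2
        rw [h, mem_spF] at this
        simp only [Prod.mk.injEq, hii] at this
        omega
    · exact Or.inl
  · intro j hj v
    have h1 : (Spider d l').G.Adj ⟨q0 (j + 1), hq0 (j + 1)⟩ v ↔ spG.Adj (q0 (j + 1)) v.1 := Iff.rfl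
    have h2 : ∀ k, (v = ⟨q0 k, hq0 k⟩) ↔ v.1 = q0 k := fun k => Subtype.ext_iff
    rw [h1, h2, h2, hq (j + 1) (l i - (j + 1)) (by omega), spG_adj, or_comm,
      hq j (l i - (j + 1) + 1) (by omega)]
    refine or_congr Iff.rfl ?_
    simp only [q0]
    rw [show l i + 1 - (j + 2) = l i - (j + 1) by omega]
  · intro h
    have h1 : (a, 1) = (b, 1) := congrArg Subtype.val h
    exact hab (Prod.mk.inj h1).1
  · change spG.Adj (q0 (l i + 1)) (a, 1)
    rw [hqe]; exact spG_adj_zero a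
  · change spG.Adj (q0 (l i + 1)) (b, 1)
    rw [hqe]; exact spG_adj_zero b
  · intro h
    have h1 : (a, 1) = q0 (l i) := congrArg Subtype.val h
    rw [hq (l i) 0 (by omega)] at h1
    exact hai (Prod.mk.inj h1).1
  · intro h
    have h1 : (b, 1) = q0 (l i) := congrArg Subtype.val h
    rw [hq (l i) 0 (by omega)] at h1
    exact hbi (Prod.mk.inj h1).1

/-- The Graham sequence of a spider. -/
noncomputable def sg (d m : ℕ) (l : ℕ → ℕ) : ℕ := Nat.card (lineIter m (Spider d l)).V

theorem sg_succ {d m : ℕ} {l : ℕ → ℕ} {i : ℕ} (hi : i < d) (hd : 3 ≤ d)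
    (hl : ∀ j < d, 1 ≤ l j) (hm : m ≤ l i) :
    sg d m (Function.update l i (l i + 1)) = sg d m l + 1 := by
  have h := spider_ext d l i hi hd hl
  rw [show l i = (l i - m) + m by omega] at h
  have := ext_card (ext_iter m (l i - m) h)
  rwa [show (l i - m) + m = l i by omega] at this

theorem sg_two {d m : ℕ} {l : ℕ → ℕ} {i : ℕ} (hi : i < d) (hd : 3 ≤ d)
    (hl : ∀ j < d, 1 ≤ l j) (hm : m = l i + 2) :
    sg d m l + 2 ≤ sg d m (Function.update l i (l i + 1)) := by
  subst hm
  have h := spider_ext d l i hi hd hl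
  exact ext_card_two (ext_iter (l i) 0 (by rwa [Nat.zero_add]))

theorem sg_add {d m : ℕ} {l : ℕ → ℕ} {i : ℕ} (hi : i < d) (hd : 3 ≤ d)
    (hl : ∀ j < d, 1 ≤ l j) (hm : m ≤ l i) (r : ℕ) :
    sg d m (Function.update l i (l i + r)) = sg d m l + r := by
  induction r with
  | zero => simp
  | succ r ih =>
    have h := sg_succ (l := Function.update l i (l i + r)) (m := m) hi hd
      (by
        intro j hj
        by_cases hji : j = i
        · subst hji
          have := hl j hj
          simp only [Function.update_self]
          omega
        · rw [Function.update_of_ne hji]; exact hl j hj)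
      (by simp only [Function.update_self]; omega)
    simp only [Function.update_self, Function.update_idem] at h
    rw [← add_assoc, h, ih, add_assoc]

theorem sg_sum {d m : ℕ} {l g : ℕ → ℕ} (hd : 3 ≤ d)
    (hl : ∀ j < d, 1 ≤ l j) (hg : ∀ j < d, g j ≠ 0 → m ≤ l j) (k : ℕ) (hk : k ≤ d) :
    sg d m (fun j => if j < k then l j + g j else l j) = sg d m l + ∑ j ∈ Finset.range k, g j := by
  induction k with
  | zero => simp
  | succ k ih =>
    rw [Finset.sum_range_succ, ← add_assoc, ← ih (by omega)]
    set L := fun j => if j < k then l j + g j else l j with hL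
    have hLk : L k = l k := by simp [L]
    have hfun : (fun j => if j < k + 1 then l j + g j else l j) =
        Function.update L k (L k + g k) := by
      funext j
      by_cases hjk : j = k
      · subst hjk; simp [hLk]
      · rw [Function.update_of_ne hjk]
        simp only [L, show j < k + 1 ↔ j < k by omega]
    rw [hfun]
    by_cases h0 : g k = 0
    · rw [h0]; simp
    · refine sg_add (by omega) hd ?_ (hLk ▸ hg k (by omega) h0) _
      intro j hj
      have := hl j hj
      simp only [L]
      split_ifs <;> omega

theorem spider_congr {d : ℕ} {l l' : ℕ → ℕ} (h : ∀ j < d, l j = l' j) :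
    Spider d l = Spider d l' := by
  have : spF d l = spF d l' := by
    ext p
    rw [mem_spF, mem_spF]
    refine or_congr Iff.rfl (and_congr_right fun hp => ?_)
    rw [h _ hp]
  unfold Spider
  rw [this]

/-- Cutting off the legs at length `m`. -/
theorem sg_trunc {d m : ℕ} {l t : ℕ → ℕ} (hd : 3 ≤ d) (ht1 : ∀ j < d, 1 ≤ t j)
    (ht : ∀ j < d, t j = l j ∨ (m ≤ t j ∧ t j ≤ l j)) :
    sg d m l + ∑ j ∈ Finset.range d, t j = sg d m t + ∑ j ∈ Finset.range d, l j := by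
  have h := sg_sum (l := t) (g := fun j => l j - t j) (m := m) hd ht1
    (by intro j hj h; have := ht j hj; omega) d le_rfl
  have h2 : sg d m (fun j => if j < d then t j + (l j - t j) else t j) = sg d m l := by
    unfold sg
    rw [spider_congr]
    intro j hj
    have := ht j hj
    simp only [hj, if_true]
    omega
  rw [h2] at h
  rw [h, add_assoc, ← Finset.sum_add_distrib]
  congr 1
  refine Finset.sum_congr rfl fun j hj => ?_
  have := ht j (Finset.mem_range.1 hj)
  omega

/-- If two spiders have the same size and their legs agree below the index `i`, differ at `i`
and are long above `i`, they are distinguished. -/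
theorem sg_lt {d i : ℕ} {l l' : ℕ → ℕ} (hd : 3 ≤ d) (hi : i < d) (hl : ∀ j < d, 1 ≤ l j)
    (hsum : ∑ j ∈ Finset.range d, l j = ∑ j ∈ Finset.range d, l' j)
    (hlt : ∀ j < i, l j = l' j) (heq : l' i = l i + 1)
    (hgt : ∀ j, i < j → j < d → l i + 2 ≤ l j ∧ l i + 2 ≤ l' j) :
    sg d (l i + 2) l < sg d (l i + 2) l' := by
  let t : ℕ → ℕ := fun j => if j ≤ i then l j else l i + 2
  have hti : t i = l i := by simp [t]
  have ht1 : ∀ j < d, 1 ≤ t j := by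
    intro j hj
    have := hl j hj
    simp only [t]
    split_ifs <;> omega
  have h1 := sg_trunc (m := l i + 2) (l := l) (t := t) hd ht1 (by
    intro j hj
    simp only [t]
    split_ifs with h
    · exact Or.inl rfl
    · exact Or.inr ⟨le_rfl, (hgt j (by omega) hj).1⟩)
  let t' := Function.update t i (t i + 1)
  have ht' : ∀ j, j ≠ i → t' j = t j := fun j hj => by simp [t', hj]
  have hti' : t' i = l i + 1 := by simp [t', hti]
  have h2 := sg_trunc (m := l i + 2) (l := l') (t := t') hd (by
    intro j hj
    by_cases h : j = i
    · subst h; omega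
    · rw [ht' j h]; exact ht1 j hj) (by
    intro j hj
    rcases lt_trichotomy j i with h | h | h
    · left
      rw [ht' j h.ne, ← hlt j h]
      simp only [t]
      rw [if_pos h.le]
    · subst h; left; omega
    · right
      rw [ht' j h.ne']
      simp only [t]
      rw [if_neg (by omega)]
      exact ⟨le_rfl, (hgt j h hj).2⟩)
  have h3 := sg_two (m := l i + 2) (l := t) hi hd ht1 (by rw [hti])
  have h4 : ∑ j ∈ Finset.range d, t' j = ∑ j ∈ Finset.range d, t j + 1 := by
    have hmem : i ∈ Finset.range d := Finset.mem_range.2 hi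
    rw [← Finset.add_sum_erase _ _ hmem, ← Finset.add_sum_erase _ t hmem, hti', hti]
    have h5 : ∑ j ∈ (Finset.range d).erase i, t' j = ∑ j ∈ (Finset.range d).erase i, t j :=
      Finset.sum_congr rfl (fun j hj => ht' j (Finset.ne_of_mem_erase hj))
    omega
  change sg d (l i + 2) t + 2 ≤ sg d (l i + 2) t' at h3
  omega

/-- Leg lengths attached to a subset of `range M`. -/
def legs (n M : ℕ) (A : Finset ℕ) (j : ℕ) : ℕ :=
  if j < M then 2 * j + 1 + (if j ∈ A then 1 else 0)
  else n - 1 - ∑ j ∈ Finset.range M, (2 * j + 1 + (if j ∈ A then 1 else 0))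

theorem sum_le_aux (M : ℕ) (A : Finset ℕ) :
    ∑ j ∈ Finset.range M, (2 * j + 1 + (if j ∈ A then 1 else 0)) ≤ M * M + M := by
  induction M with
  | zero => simp
  | succ M ih =>
    rw [Finset.sum_range_succ]
    have : (if M ∈ A then 1 else 0) ≤ 1 := by split_ifs <;> omega
    nlinarith

theorem legs_last {n M : ℕ} (hn : (M + 2) * (M + 2) ≤ n) (A : Finset ℕ) :
    2 * M + 2 ≤ legs n M A M := by
  have := sum_le_aux M A
  simp only [legs, lt_irrefl, if_false]
  have h : (M + 2) * (M + 2) = M * M + 4 * M + 4 := by ring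
  omega

theorem legs_sum {n M : ℕ} (hn : (M + 2) * (M + 2) ≤ n) (A : Finset ℕ) :
    ∑ j ∈ Finset.range (M + 1), legs n M A j = n - 1 := by
  have := sum_le_aux M A
  have h : (M + 2) * (M + 2) = M * M + 4 * M + 4 := by ring
  rw [Finset.sum_range_succ]
  have h2 : ∑ j ∈ Finset.range M, legs n M A j =
      ∑ j ∈ Finset.range M, (2 * j + 1 + (if j ∈ A then 1 else 0)) := by
    refine Finset.sum_congr rfl fun j hj => ?_
    simp only [legs, if_pos (Finset.mem_range.1 hj)]
  rw [h2]
  simp only [legs, lt_irrefl, if_false]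
  omega

theorem legs_pos {n M : ℕ} (hn : (M + 2) * (M + 2) ≤ n) (A : Finset ℕ) :
    ∀ j < M + 1, 1 ≤ legs n M A j := by
  intro j hj
  by_cases h : j < M
  · simp only [legs, if_pos h]; omega
  · have : j = M := by omega
    subst this
    have := legs_last hn A
    omega

theorem legs_lt {n M : ℕ} (hM : 2 ≤ M) (hn : (M + 2) * (M + 2) ≤ n) (A B : Finset ℕ) (i : ℕ)
    (hi : i < M) (hA : i ∉ A) (hB : i ∈ B) (hlt : ∀ j < i, (j ∈ A ↔ j ∈ B)) :
    ∃ m, sg (M + 1) m (legs n M A) ≠ sg (M + 1) m (legs n M B) := by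
  have hAi : legs n M A i = 2 * i + 1 := by simp [legs, hi, hA]
  have hBi : legs n M B i = 2 * i + 2 := by simp [legs, hi, hB]
  refine ⟨_, (sg_lt (i := i) (by omega) (by omega) (legs_pos hn A) ?_ ?_ ?_ ?_).ne⟩
  · rw [legs_sum hn, legs_sum hn]
  · intro j hj
    simp only [legs, if_pos (show j < M by omega), hlt j hj]
  · omega
  · intro j hij hj
    rw [hAi]
    by_cases h : j < M
    · simp only [legs, if_pos h]
      omega
    · have : j = M := by omega
      subst this
      have := legs_last hn A
      have := legs_last hn B
      omega

theorem legs_ne {n M : ℕ} (hM : 2 ≤ M) (hn : (M + 2) * (M + 2) ≤ n) (A B : Finset ℕ)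
    (hA : A ⊆ Finset.range M) (hB : B ⊆ Finset.range M) (hAB : A ≠ B) :
    ∃ m, sg (M + 1) m (legs n M A) ≠ sg (M + 1) m (legs n M B) := by
  classical
  have hex : ∃ i, ¬ (i ∈ A ↔ i ∈ B) := by
    by_contra h
    push Not at h
    exact hAB (Finset.ext h)
  have hlt : ∀ j < Nat.find hex, (j ∈ A ↔ j ∈ B) := fun j hj => not_not.1 (Nat.find_min hex hj)
  have hsp := Nat.find_spec hex
  by_cases h : Nat.find hex ∈ A
  · have hb : Nat.find hex ∉ B := fun hb => hsp (iff_of_true h hb)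
    obtain ⟨m, hm⟩ := legs_lt hM hn B A _ (Finset.mem_range.1 (hA h)) hb h
      (fun j hj => (hlt j hj).symm)
    exact ⟨m, hm.symm⟩
  · have hb : Nat.find hex ∈ B := by
      by_contra hb
      exact hsp (iff_of_false h hb)
    exact legs_lt hM hn A B _ (Finset.mem_range.1 (hB hb)) h hb hlt

theorem spider_mem {n M : ℕ} (hn : (M + 2) * (M + 2) ≤ n) (A : Finset ℕ) :
    (fun k => sg (M + 1) k (legs n M A)) ∈ {s : ℕ → ℕ | ∃ G : SimpleGraph (Fin n), G.IsTree ∧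
            ∀ k : ℕ, s k = Nat.card (lineIter k (FGraph.mk (Fin n) G)).V} := by
  have hn0 : 0 < n := lt_of_lt_of_le (by positivity) hn
  have hc : Fintype.card (Spider (M + 1) (legs n M A)).V = n := by
    have h1 : Nat.card {p // p ∈ spF (M + 1) (legs n M A)} = n := by
      rw [Nat.card_eq_fintype_card, Fintype.card_coe, card_spF, legs_sum hn]
      omega
    rw [← Nat.card_eq_fintype_card]
    exact h1
  let e := Fintype.equivFinOfCardEq hc
  let φ := SimpleGraph.Iso.map e (Spider (M + 1) (legs n M A)).G
  refine ⟨(Spider (M + 1) (legs n M A)).G.map e.toEmbedding, ?_, ?_⟩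
  · exact φ.isTree_iff.1 (spider_tree _ _)
  · intro k
    obtain ⟨ψ⟩ := iso_iter (H := Spider (M + 1) (legs n M A))
      (H' := FGraph.mk (Fin n) ((Spider (M + 1) (legs n M A)).G.map e.toEmbedding)) ⟨φ⟩ k
    exact Nat.card_congr ψ.toEquiv

theorem classes_finite (n : ℕ) : {s : ℕ → ℕ | ∃ G : SimpleGraph (Fin n), G.IsTree ∧
            ∀ k : ℕ, s k = Nat.card (lineIter k (FGraph.mk (Fin n) G)).V}.Finite := by
  refine (Set.finite_range (fun G : SimpleGraph (Fin n) =>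
    fun k => Nat.card (lineIter k (FGraph.mk (Fin n) G)).V)).subset ?_
  rintro s ⟨G, -, h⟩
  exact ⟨G, (funext h).symm⟩

theorem classes_card {n M : ℕ} (hM : 2 ≤ M) (hn : (M + 2) * (M + 2) ≤ n) :
    2 ^ M ≤ {s : ℕ → ℕ | ∃ G : SimpleGraph (Fin n), G.IsTree ∧
            ∀ k : ℕ, s k = Nat.card (lineIter k (FGraph.mk (Fin n) G)).V}.ncard := by
  have h1 : ((Finset.range M).powerset : Set (Finset ℕ)).ncard = 2 ^ M := by
    rw [Set.ncard_coe_finset, Finset.card_powerset, Finset.card_range]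
  rw [← h1]
  refine Set.ncard_le_ncard_of_injOn (fun A k => sg (M + 1) k (legs n M A)) ?_ ?_
    (classes_finite n)
  · intro A _
    exact spider_mem hn A
  · intro A hA B hB h
    by_contra hAB
    obtain ⟨m, hm⟩ := legs_ne hM hn A B (Finset.mem_powerset.1 hA) (Finset.mem_powerset.1 hB) hAB
    exact hm (congrFun h m)

theorem analytic_bound : ∃ N : ℕ, ∀ n ≥ N,
    (Real.log n) ^ ((3 : ℝ) / 2) ≤ (1 / 4) * Real.sqrt n := by
  have h := (isLittleO_log_rpow_rpow_atTop (s := 1 / 2) ((3 : ℝ) / 2) (by norm_num)).def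
    (show (0 : ℝ) < 1 / 4 by norm_num)
  have h2 := tendsto_natCast_atTop_atTop (R := ℝ) |>.eventually h
  obtain ⟨N, hN⟩ := Filter.eventually_atTop.1 h2
  refine ⟨N, fun n hn => ?_⟩
  have h3 := hN n hn
  rw [Real.sqrt_eq_rpow]
  rw [Real.norm_of_nonneg (Real.rpow_nonneg (Nat.cast_nonneg n) _)] at h3
  exact (le_abs_self _).trans h3

theorem graham_classes_lower_bound :
    ∃ c : ℝ, 0 < c ∧ ∃ N : ℕ, ∀ n ≥ N,
      Real.exp (c * (Real.log n) ^ ((3 : ℝ) / 2)) ≤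
        ({s : ℕ → ℕ | ∃ G : SimpleGraph (Fin n), G.IsTree ∧
            ∀ k : ℕ, s k = Nat.card (lineIter k (FGraph.mk (Fin n) G)).V}.ncard : ℝ) := by
  obtain ⟨N, hN⟩ := analytic_bound
  refine ⟨1, one_pos, max N 100, fun n hn => ?_⟩
  have hn1 := hN n (le_trans (le_max_left _ _) hn)
  have hn2 : 100 ≤ n := le_trans (le_max_right _ _) hn
  have hs : 10 ≤ Nat.sqrt n := Nat.le_sqrt.2 (by omega)
  obtain ⟨M, hM⟩ : ∃ M, Nat.sqrt n = M + 2 := ⟨Nat.sqrt n - 2, by omega⟩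
  have hcard := classes_card (n := n) (M := M) (by omega) (hM ▸ Nat.sqrt_le n)
  have hlt : n < (M + 3) * (M + 3) := by
    have := Nat.lt_succ_sqrt n
    rw [hM] at this
    exact this
  have hsq : Real.sqrt n ≤ M + 3 := by
    rw [Real.sqrt_le_left (by positivity)]
    have : (n : ℝ) ≤ (M + 3) * (M + 3) := by exact_mod_cast hlt.le
    linarith [sq ((M : ℝ) + 3)]
  have hM8 : (8 : ℝ) ≤ M := by exact_mod_cast (show 8 ≤ M by omega)
  have hlog : (1 : ℝ) / 2 ≤ Real.log 2 := by linarith [Real.log_two_gt_d9]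
  calc Real.exp (1 * (Real.log n) ^ ((3 : ℝ) / 2)) ≤ Real.exp (M * Real.log 2) := by
        apply Real.exp_le_exp.2
        nlinarith
    _ = (2 : ℝ) ^ M := by
        rw [Real.exp_nat_mul, Real.exp_log (by norm_num)]
    _ ≤ _ := by exact_mod_cast hcard
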